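/- Let π be a probability distribution on ℝ with mean 0 and variance 1, and suppose the product of two independent copies of π is sub-Gaussian with variance proxy σ², i.e. E[exp(t·X·X')] ≤ exp(σ² t² / 2) for all t ∈ ℝ, where X, X' are independent with law π. Let (X_i)_{i≥1} and (X'_i)_{i≥1} be i.i.d. sequences with law π, all independent. If 0 ≤ λ < 1/σ, then E[ exp( (λ²/(2n)) · (Σ_{i=1}^n X_i X'_i)² ) ] → (1−λ²)^{−1/2} as n → ∞; in particular this second moment remains bounded, and the spiked Gaussian Wigner model GWig(λ, iid(π)) is contiguous to GWig(0). -/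

import Mathlib

open MeasureTheory Filter Topology ProbabilityTheory
open scoped ENNReal NNReal

/-- A sequence of probability measures `P n` is contiguous to `Q n` if for every
sequence of measurable events `A n`, `Q n (A n) → 0` implies `P n (A n) → 0`. -/
def Contiguous {Ω : ℕ → Type*} [∀ n, MeasurableSpace (Ω n)]
    (P Q : (n : ℕ) → Measure (Ω n)) : Prop :=
  ∀ A : (n : ℕ) → Set (Ω n), (∀ n, MeasurableSet (A n)) →
    Tendsto (fun n => Q n (A n)) atTop (𝓝 0) →
    Tendsto (fun n => P n (A n)) atTop (𝓝 0)

/-- The unspiked Gaussian Wigner measure `GWig_n(0)`. -/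
noncomputable def gwigUnspiked (n : ℕ) : Measure (Fin n → Fin n → ℝ) :=
  (Measure.pi fun _ : Fin n × Fin n => gaussianReal 0 (1 / (2 * (n : ℝ≥0)))).map
    fun W i j => W (i, j) + W (j, i)

/-- The spiked Gaussian Wigner measure `GWig_n(λ, 𝒳)`: mixture over `x ~ 𝒳` of the
pushforward of `GWig_n(0)` under `Y ↦ λ x xᵀ + Y`. -/
noncomputable def gwigSpiked (n : ℕ) (lam : ℝ) (prior : Measure (Fin n → ℝ)) :
    Measure (Fin n → Fin n → ℝ) :=
  prior.bind fun x => (gwigUnspiked n).map fun Y i j => lam * (x i * x j) + Y i j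

/-- The i.i.d. prior `iid(π)`: each coordinate of `x ∈ ℝⁿ` is drawn independently
from `(1/√n) π`. -/
noncomputable def iidPrior (n : ℕ) (π : Measure ℝ) [SigmaFinite π] : Measure (Fin n → ℝ) :=
  (Measure.pi fun _ : Fin n => π).map fun v => (Real.sqrt n)⁻¹ • v

theorem lintegral_pi_prod {ι : Type*} [Fintype ι] {E : ι → Type*} [∀ i, MeasurableSpace (E i)]
    (μ : (i : ι) → Measure (E i)) [∀ i, IsProbabilityMeasure (μ i)]
    {f : (i : ι) → E i → ℝ≥0∞} (hf : ∀ i, Measurable (f i)) :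
    ∫⁻ x, ∏ i, f i (x i) ∂(Measure.pi μ) = ∏ i, ∫⁻ y, f i y ∂(μ i) := by
  have h := lintegral_prod_eq_prod_lintegral_of_indepFun Finset.univ
    (fun i (x : (i : ι) → E i) => f i (x i)) (iIndepFun_pi (μ := μ) fun i => (hf i).aemeasurable)
    fun i => (hf i).comp (measurable_pi_apply i)
  rw [h]
  refine Finset.prod_congr rfl fun i _ => ?_
  exact (measurePreserving_eval μ i).lintegral_comp (hf i)

theorem withDensity_pi_prod {ι : Type*} [Fintype ι] {E : ι → Type*} [∀ i, MeasurableSpace (E i)]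
    (μ : (i : ι) → Measure (E i)) [∀ i, IsProbabilityMeasure (μ i)]
    {f : (i : ι) → E i → ℝ≥0∞} (hf : ∀ i, Measurable (f i))
    [∀ i, SigmaFinite ((μ i).withDensity (f i))] :
    Measure.pi (fun i => (μ i).withDensity (f i))
      = (Measure.pi μ).withDensity fun x => ∏ i, f i (x i) := by
  classical
  refine Measure.pi_eq fun s hs => ?_
  rw [withDensity_apply _ (MeasurableSet.univ_pi hs),
    ← lintegral_indicator (MeasurableSet.univ_pi hs)]
  have h : ∀ x : (i : ι) → E i, (Set.univ.pi s).indicator (fun x => ∏ i, f i (x i)) x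
      = ∏ i, (s i).indicator (f i) (x i) := by
    intro x
    by_cases hx : x ∈ Set.univ.pi s
    · rw [Set.indicator_of_mem hx]
      refine Finset.prod_congr rfl fun i _ => ?_
      rw [Set.indicator_of_mem (hx i (Set.mem_univ i))]
    · rw [Set.indicator_of_notMem hx]
      simp only [Set.mem_pi, Set.mem_univ, true_imp_iff, not_forall] at hx
      obtain ⟨i, hi⟩ := hx
      exact (Finset.prod_eq_zero (Finset.mem_univ i) (Set.indicator_of_notMem hi _)).symm
  simp_rw [h]
  rw [lintegral_pi_prod μ fun i => (hf i).indicator (hs i)]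
  refine Finset.prod_congr rfl fun i _ => ?_
  rw [lintegral_indicator (hs i), withDensity_apply _ (hs i)]

theorem lintegral_exp_mul_gaussianReal (v : ℝ≥0) (t : ℝ) :
    ∫⁻ g, ENNReal.ofReal (Real.exp (t * g)) ∂(gaussianReal 0 v)
      = ENNReal.ofReal (Real.exp (v * t ^ 2 / 2)) := by
  rw [← ofReal_integral_eq_lintegral_ofReal (integrable_exp_mul_gaussianReal t)
    (ae_of_all _ fun _ => (Real.exp_pos _).le)]
  congr 1
  simpa [mgf] using mgf_gaussianReal (p := gaussianReal 0 v) (X := id) Measure.map_id t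

theorem lintegral_exp_mul_sq_gaussianReal {b : ℝ} (hb : b < 1) :
    ∫⁻ g, ENNReal.ofReal (Real.exp (b * g ^ 2 / 2)) ∂(gaussianReal 0 1)
      = ENNReal.ofReal ((1 - b) ^ (-(1 : ℝ) / 2)) := by
  have hc : 0 < 1 - b := by linarith
  set v : ℝ≥0 := ⟨(1 - b)⁻¹, (inv_pos.2 hc).le⟩ with hv
  have hvc : (v : ℝ) = (1 - b)⁻¹ := rfl
  have hv0 : v ≠ 0 := by
    intro h
    have : (v : ℝ) = 0 := by rw [h]; rfl
    rw [hvc] at this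
    exact (inv_pos.2 hc).ne' this
  rw [gaussianReal_of_var_ne_zero _ one_ne_zero,
    lintegral_withDensity_eq_lintegral_mul _ (measurable_gaussianPDF _ _) (by fun_prop)]
  have h : ∀ g : ℝ, (gaussianPDF 0 1 * fun g => ENNReal.ofReal (Real.exp (b * g ^ 2 / 2))) g
      = ENNReal.ofReal ((1 - b) ^ (-(1 : ℝ) / 2)) * gaussianPDF 0 v g := by
    intro g
    rw [Pi.mul_apply, gaussianPDF, gaussianPDF, ← ENNReal.ofReal_mul (gaussianPDFReal_nonneg _ _ _),
      ← ENNReal.ofReal_mul (by positivity)]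
    congr 1
    have e1 : (1 - b) ^ (-(1 : ℝ) / 2) = (√(1 - b))⁻¹ := by
      rw [neg_div, Real.rpow_neg hc.le, Real.sqrt_eq_rpow]
    have e2 : √(2 * Real.pi * (1 - b)⁻¹) = √(2 * Real.pi) * (√(1 - b))⁻¹ := by
      rw [Real.sqrt_mul (by positivity), Real.sqrt_inv]
    have e3 : √(1 - b) ≠ 0 := (Real.sqrt_pos.2 hc).ne'
    simp only [gaussianPDFReal, hvc, e1, e2, NNReal.coe_one, mul_one, sub_zero]
    rw [mul_assoc, ← Real.exp_add, mul_inv, inv_inv]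
    have e4 : -g ^ 2 / 2 + b * g ^ 2 / 2 = -g ^ 2 / (2 * (1 - b)⁻¹) := by
      field_simp
      ring
    rw [e4]
    field_simp
  simp_rw [h]
  rw [lintegral_const_mul _ (measurable_gaussianPDF _ _), lintegral_gaussianPDF_eq_one _ hv0,
    mul_one]

theorem gaussianReal_eq_withDensity_exp (m : ℝ) {v : ℝ≥0} (hv : v ≠ 0) :
    gaussianReal m v = (gaussianReal 0 v).withDensity
      fun w => ENNReal.ofReal (Real.exp ((m * w - m ^ 2 / 2) / v)) := by
  have hv' : (v : ℝ) ≠ 0 := by exact_mod_cast hv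
  rw [gaussianReal_of_var_ne_zero _ hv, gaussianReal_of_var_ne_zero _ hv,
    ← withDensity_mul _ (measurable_gaussianPDF _ _) (by fun_prop)]
  congr 1
  ext w
  rw [Pi.mul_apply, gaussianPDF, gaussianPDF, ← ENNReal.ofReal_mul (gaussianPDFReal_nonneg _ _ _)]
  congr 1
  simp only [gaussianPDFReal]
  rw [mul_assoc _ (Real.exp _) (Real.exp _), ← Real.exp_add]
  congr 2
  field_simp
  ring

theorem lintegral_exp_mul_exp_gaussianReal (m m' : ℝ) {v : ℝ≥0} (hv : v ≠ 0) :
    ∫⁻ w, ENNReal.ofReal (Real.exp ((m * w - m ^ 2 / 2) / v))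
        * ENNReal.ofReal (Real.exp ((m' * w - m' ^ 2 / 2) / v)) ∂(gaussianReal 0 v)
      = ENNReal.ofReal (Real.exp (m * m' / v)) := by
  have hv' : (v : ℝ) ≠ 0 := by exact_mod_cast hv
  have h : ∀ w : ℝ, ENNReal.ofReal (Real.exp ((m * w - m ^ 2 / 2) / v))
        * ENNReal.ofReal (Real.exp ((m' * w - m' ^ 2 / 2) / v))
      = ENNReal.ofReal (Real.exp (-(m ^ 2 + m' ^ 2) / (2 * v)))
        * ENNReal.ofReal (Real.exp ((m + m') / v * w)) := by
    intro w
    rw [← ENNReal.ofReal_mul (Real.exp_pos _).le, ← ENNReal.ofReal_mul (Real.exp_pos _).le,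
      ← Real.exp_add, ← Real.exp_add]
    congr 2
    field_simp
    ring
  simp_rw [h]
  rw [lintegral_const_mul _ (by fun_prop), lintegral_exp_mul_gaussianReal,
    ← ENNReal.ofReal_mul (Real.exp_pos _).le, ← Real.exp_add]
  congr 2
  field_simp
  ring

theorem map_add_pi_gaussianReal {ι : Type*} [Fintype ι] (m : ι → ℝ) {v : ℝ≥0} (hv : v ≠ 0) :
    (Measure.pi fun _ : ι => gaussianReal 0 v).map (fun W i => W i + m i)
      = (Measure.pi fun _ : ι => gaussianReal 0 v).withDensity
        fun W => ∏ i, ENNReal.ofReal (Real.exp ((m i * W i - m i ^ 2 / 2) / v)) := by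
  have h (i : ι) : (gaussianReal 0 v).map (fun w => w + m i) = gaussianReal (m i) v := by
    rw [gaussianReal_map_add_const, zero_add]
  have (i : ι) : SigmaFinite ((gaussianReal 0 v).map (fun w => w + m i)) := by
    rw [h]; infer_instance
  rw [Measure.pi_map_pi (f := fun i w => w + m i) fun i => by fun_prop]
  simp_rw [h]
  have hd (i : ι) := gaussianReal_eq_withDensity_exp (m i) hv
  have (i : ι) : SigmaFinite ((gaussianReal 0 v).withDensity
      fun w => ENNReal.ofReal (Real.exp ((m i * w - m i ^ 2 / 2) / v))) := by
    rw [← hd]; infer_instance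
  simp_rw [hd]
  exact withDensity_pi_prod (fun _ => gaussianReal 0 v) fun i => by fun_prop

theorem lintegral_setLIntegral_le_sqrt_mul_sqrt {X Ω : Type*} [MeasurableSpace X]
    [MeasurableSpace Ω] (ρ : Measure X) [SFinite ρ] (Γ : Measure Ω) [SFinite Γ]
    {L : X → Ω → ℝ≥0∞} (hL : Measurable (Function.uncurry L)) {B : Set Ω} (hB : MeasurableSet B) :
    ∫⁻ x, ∫⁻ w in B, L x w ∂Γ ∂ρ
      ≤ Γ B ^ (1 / 2 : ℝ)
        * (∫⁻ q, ∫⁻ w, L q.1 w * L q.2 w ∂Γ ∂(ρ.prod ρ)) ^ (1 / 2 : ℝ) := by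
  have hΛ : Measurable fun w => ∫⁻ x, L x w ∂ρ :=
    Measurable.lintegral_prod_left' (f := Function.uncurry L) hL
  have hLw : ∀ w, Measurable fun x => L x w := fun w => hL.comp (measurable_id.prodMk measurable_const)
  have h1 : ∫⁻ x, ∫⁻ w in B, L x w ∂Γ ∂ρ
      = ∫⁻ w, ((B.indicator 1 : Ω → ℝ≥0∞) * fun w => ∫⁻ x, L x w ∂ρ) w ∂Γ := by
    rw [lintegral_lintegral_swap hL.aemeasurable, ← lintegral_indicator hB]
    refine lintegral_congr fun w => ?_
    by_cases hw : w ∈ B <;> simp [hw]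
  have h2 : ∫⁻ w, (B.indicator 1 : Ω → ℝ≥0∞) w ^ (2 : ℝ) ∂Γ = Γ B := by
    rw [← lintegral_indicator_one hB]
    refine lintegral_congr fun w => ?_
    by_cases hw : w ∈ B <;> simp [hw]
  have h3 : ∫⁻ w, (∫⁻ x, L x w ∂ρ) ^ (2 : ℝ) ∂Γ
      = ∫⁻ q, ∫⁻ w, L q.1 w * L q.2 w ∂Γ ∂(ρ.prod ρ) := by
    rw [lintegral_lintegral_swap]
    · refine lintegral_congr fun w => ?_
      rw [lintegral_prod_mul (hLw w).aemeasurable (hLw w).aemeasurable, ENNReal.rpow_two, sq]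
    · refine Measurable.aemeasurable (Measurable.mul ?_ ?_)
      · exact hL.comp ((measurable_fst.comp measurable_fst).prodMk measurable_snd)
      · exact hL.comp ((measurable_snd.comp measurable_fst).prodMk measurable_snd)
  rw [h1, ← h3, ← h2]
  exact ENNReal.lintegral_mul_le_Lp_mul_Lq Γ Real.HolderConjugate.two_two
    (measurable_one.indicator hB).aemeasurable hΛ.aemeasurable

theorem integrable_exp_mul_of_lintegral_le {Ω : Type*} [MeasurableSpace Ω] {μ : Measure Ω}
    {X : Ω → ℝ} (hX : Measurable X) {t c : ℝ}
    (h : ∫⁻ ω, ENNReal.ofReal (Real.exp (t * X ω)) ∂μ ≤ ENNReal.ofReal c) :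
    Integrable (fun ω => Real.exp (t * X ω)) μ := by
  refine ⟨by fun_prop, ?_⟩
  rw [hasFiniteIntegral_iff_ofReal (ae_of_all _ fun _ => (Real.exp_pos _).le)]
  exact h.trans_lt ENNReal.ofReal_lt_top

theorem tendsto_mgf_div_sqrt_pow {Ω : Type*} [MeasurableSpace Ω] {μ : Measure Ω}
    [IsProbabilityMeasure μ] {X : Ω → ℝ} (hX : ∀ t, Integrable (fun ω => Real.exp (t * X ω)) μ)
    (hmean : ∫ ω, X ω ∂μ = 0) (hvar : ∫ ω, X ω ^ 2 ∂μ = 1) (t : ℝ) :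
    Tendsto (fun n : ℕ => mgf X μ (t / √n) ^ n) atTop (𝓝 (Real.exp (t ^ 2 / 2))) := by
  have hset : integrableExpSet X μ = Set.univ := Set.eq_univ_of_forall hX
  have hint (t : ℝ) : t ∈ interior (integrableExpSet X μ) := by simp [hset]
  have hcd : ContDiff ℝ 2 (mgf X μ) :=
    contDiff_iff_contDiffAt.2 fun t => (analyticAt_mgf (hint t)).contDiffAt
  have htay := taylor_isLittleO_univ (x₀ := 0) (n := 2) hcd
  have heval (x : ℝ) : taylorWithinEval (mgf X μ) 2 Set.univ 0 x = 1 + x ^ 2 / 2 := by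
    rw [taylorWithinEval_succ, taylorWithinEval_succ, taylor_within_zero_eval]
    simp only [iteratedDerivWithin_univ, iteratedDeriv_mgf_zero (hint 0)]
    simp [hmean, hvar]
    ring
  simp_rw [heval, sub_zero] at htay
  have hlim : Tendsto (fun n : ℕ => t / √(n : ℝ)) atTop (𝓝 0) :=
    (Real.tendsto_sqrt_atTop.comp tendsto_natCast_atTop_atTop).const_div_atTop t
  have h := htay.comp_tendsto hlim
  have hO : ((fun x : ℝ => x ^ 2) ∘ fun n : ℕ => t / √(n : ℝ)) =O[atTop]
      fun n : ℕ => 1 / (n : ℝ) := by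
    refine .of_bound (t ^ 2) (Eventually.of_forall fun n => ?_)
    simp only [Function.comp, div_pow, Real.sq_sqrt (Nat.cast_nonneg n)]
    rw [Real.norm_of_nonneg (by positivity), Real.norm_of_nonneg (by positivity), mul_one_div]
  have hlittle : (fun n : ℕ => mgf X μ (t / √n) - 1 - t ^ 2 / 2 / n) =o[atTop]
      fun n : ℕ => 1 / (n : ℝ) := by
    refine (h.trans_isBigO hO).congr_left fun n => ?_
    simp only [Function.comp, div_pow, Real.sq_sqrt (Nat.cast_nonneg n)]
    ring
  have hg : Tendsto (fun n : ℕ => n * (mgf X μ (t / √n) - 1)) atTop (𝓝 (t ^ 2 / 2)) := by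
    refine tendsto_sub_nhds_zero_iff.1 (hlittle.tendsto_inv_smul_nhds_zero.congr' ?_)
    filter_upwards [eventually_ne_atTop 0] with n hn
    have : (n : ℝ) ≠ 0 := by exact_mod_cast hn
    simp only [smul_eq_mul, one_div, inv_inv]
    field_simp
  refine (Real.tendsto_one_add_pow_exp_of_tendsto hg).congr fun n => ?_
  rw [add_sub_cancel]

theorem lintegral_pi_prod_pi_exp_mul_sum (π : Measure ℝ) [IsProbabilityMeasure π] (n : ℕ) (t : ℝ) :
    ∫⁻ q : (Fin n → ℝ) × (Fin n → ℝ), ENNReal.ofReal (Real.exp (t * ∑ i, q.1 i * q.2 i))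
        ∂((Measure.pi fun _ : Fin n => π).prod (Measure.pi fun _ : Fin n => π))
      = (∫⁻ q : ℝ × ℝ, ENNReal.ofReal (Real.exp (t * (q.1 * q.2))) ∂(π.prod π)) ^ n := by
  have h (q : (Fin n → ℝ) × (Fin n → ℝ)) : ENNReal.ofReal (Real.exp (t * ∑ i, q.1 i * q.2 i))
      = ∏ i, ENNReal.ofReal (Real.exp (t * (q.1 i * q.2 i))) := by
    rw [Finset.mul_sum, Real.exp_sum,
      ENNReal.ofReal_prod_of_nonneg fun i _ => (Real.exp_pos _).le]
  have hmeas : Measurable fun q : ℝ × ℝ => ENNReal.ofReal (Real.exp (t * (q.1 * q.2))) := by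
    fun_prop
  simp_rw [h]
  rw [lintegral_prod _ (by fun_prop), lintegral_prod _ hmeas.aemeasurable]
  have h2 (x : Fin n → ℝ) : ∫⁻ y : Fin n → ℝ, ∏ i, ENNReal.ofReal (Real.exp (t * (x i * y i)))
        ∂(Measure.pi fun _ : Fin n => π)
      = ∏ i, ∫⁻ y, ENNReal.ofReal (Real.exp (t * (x i * y))) ∂π :=
    lintegral_pi_prod (fun _ => π) (f := fun i y => ENNReal.ofReal (Real.exp (t * (x i * y))))
      fun i => by fun_prop
  simp_rw [h2]
  rw [lintegral_pi_prod (fun _ : Fin n => π)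
    (f := fun _ x => ∫⁻ y, ENNReal.ofReal (Real.exp (t * (x * y))) ∂π)
    fun _ => hmeas.lintegral_prod_right']
  simp

theorem lintegral_exp_sq_sum_eq_lintegral_gaussianReal (π : Measure ℝ) [IsProbabilityMeasure π]
    (lam : ℝ) (n : ℕ) :
    ∫⁻ q : (Fin n → ℝ) × (Fin n → ℝ),
        ENNReal.ofReal (Real.exp (lam ^ 2 / (2 * n) * (∑ i, q.1 i * q.2 i) ^ 2))
        ∂((Measure.pi fun _ : Fin n => π).prod (Measure.pi fun _ : Fin n => π))
      = ∫⁻ g, (∫⁻ q : ℝ × ℝ, ENNReal.ofReal (Real.exp (lam * g / √n * (q.1 * q.2)))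
          ∂(π.prod π)) ^ n ∂(gaussianReal 0 1) := by
  simp_rw [← lintegral_pi_prod_pi_exp_mul_sum]
  rw [lintegral_lintegral_swap (by
    apply Measurable.aemeasurable
    unfold Function.uncurry
    fun_prop)]
  refine lintegral_congr fun q => ?_
  have h (g : ℝ) : lam * g / √n * ∑ i, q.1 i * q.2 i = (lam * (∑ i, q.1 i * q.2 i) / √n) * g := by
    ring
  simp_rw [h]
  rw [lintegral_exp_mul_gaussianReal]
  congr 2
  rw [div_pow, Real.sq_sqrt (Nat.cast_nonneg n), NNReal.coe_one]
  ring

theorem tendsto_lintegral_exp_sq_sum (π : Measure ℝ) [IsProbabilityMeasure π]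
    (hmean : ∫ x, x ∂π = 0) (hvar : ∫ x, x ^ 2 ∂π = 1)
    {σ : ℝ} (hσ : 0 < σ)
    (hsub : ∀ t : ℝ, ∫⁻ q : ℝ × ℝ, ENNReal.ofReal (Real.exp (t * (q.1 * q.2))) ∂(π.prod π)
      ≤ ENNReal.ofReal (Real.exp (σ ^ 2 * t ^ 2 / 2)))
    {lam : ℝ} (hlam0 : 0 ≤ lam) (hlam : lam < 1 / σ) :
    Tendsto (fun n : ℕ => ∫⁻ q : (Fin n → ℝ) × (Fin n → ℝ),
        ENNReal.ofReal (Real.exp (lam ^ 2 / (2 * n) * (∑ i, q.1 i * q.2 i) ^ 2))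
        ∂((Measure.pi fun _ : Fin n => π).prod (Measure.pi fun _ : Fin n => π)))
      atTop (𝓝 (ENNReal.ofReal ((1 - lam ^ 2) ^ (-(1 : ℝ) / 2)))) := by
  set X : ℝ × ℝ → ℝ := fun q => q.1 * q.2 with hXdef
  have hint (t : ℝ) : Integrable (fun q => Real.exp (t * X q)) (π.prod π) :=
    integrable_exp_mul_of_lintegral_le (by fun_prop) (hsub t)
  have hXmean : ∫ q, X q ∂(π.prod π) = 0 := by
    rw [hXdef, integral_prod_mul (fun x : ℝ => x) (fun x : ℝ => x), hmean, zero_mul]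
  have hXvar : ∫ q, X q ^ 2 ∂(π.prod π) = 1 := by
    simp_rw [hXdef, mul_pow]
    rw [integral_prod_mul (fun x : ℝ => x ^ 2) (fun x : ℝ => x ^ 2), hvar, one_mul]
  have hmgf (t : ℝ) : ∫⁻ q : ℝ × ℝ, ENNReal.ofReal (Real.exp (t * (q.1 * q.2))) ∂(π.prod π)
      = ENNReal.ofReal (mgf X (π.prod π) t) :=
    (ofReal_integral_eq_lintegral_ofReal (hint t) (ae_of_all _ fun _ => (Real.exp_pos _).le)).symm
  have hlim := tendsto_mgf_div_sqrt_pow hint hXmean hXvar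
  have hle (t : ℝ) (n : ℕ) (hn : n ≠ 0) :
      mgf X (π.prod π) (t / √n) ^ n ≤ Real.exp (σ ^ 2 * t ^ 2 / 2) := by
    have h := hsub (t / √n)
    rw [hmgf, ENNReal.ofReal_le_ofReal_iff (Real.exp_pos _).le] at h
    refine (pow_le_pow_left₀ mgf_nonneg h n).trans_eq ?_
    rw [← Real.exp_nat_mul, div_pow, Real.sq_sqrt (Nat.cast_nonneg n)]
    congr 1
    have : (n : ℝ) ≠ 0 := by exact_mod_cast hn
    field_simp
  have hσ1 : 1 ≤ σ ^ 2 := by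
    have h := le_of_tendsto (hlim 1) ((eventually_ne_atTop 0).mono fun n hn => hle 1 n hn)
    rw [Real.exp_le_exp] at h
    linarith
  have hσlam : σ ^ 2 * lam ^ 2 < 1 := by
    rw [lt_div_iff₀ hσ] at hlam
    rw [← mul_pow, mul_comm]
    exact pow_lt_one₀ (by positivity) hlam two_ne_zero
  have hlam1 : lam ^ 2 < 1 := by nlinarith [sq_nonneg lam]
  simp_rw [lintegral_exp_sq_sum_eq_lintegral_gaussianReal]
  rw [← lintegral_exp_mul_sq_gaussianReal hlam1]
  refine tendsto_lintegral_filter_of_dominated_convergence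
    (fun g => ENNReal.ofReal (Real.exp (σ ^ 2 * lam ^ 2 * g ^ 2 / 2))) ?_ ?_ ?_ ?_
  · refine Eventually.of_forall fun n => Measurable.pow_const ?_ n
    refine Measurable.lintegral_prod_right' (ν := π.prod π)
      (f := fun p : ℝ × (ℝ × ℝ) => ENNReal.ofReal (Real.exp (lam * p.1 / √n * (p.2.1 * p.2.2)))) ?_
    fun_prop
  · filter_upwards [eventually_ne_atTop 0] with n hn
    refine ae_of_all _ fun g => ?_
    rw [hmgf, ← ENNReal.ofReal_pow mgf_nonneg]
    refine ENNReal.ofReal_le_ofReal ((hle (lam * g) n hn).trans_eq ?_)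
    ring_nf
  · rw [lintegral_exp_mul_sq_gaussianReal hσlam]
    exact ENNReal.ofReal_ne_top
  · refine ae_of_all _ fun g => ?_
    simp_rw [hmgf, ← ENNReal.ofReal_pow (mgf_nonneg (X := X) (μ := π.prod π))]
    rw [← mul_pow]
    exact ENNReal.tendsto_ofReal (hlim (lam * g))

theorem gwigSpiked_apply_le (n : ℕ) (lam : ℝ) (prior : Measure (Fin n → ℝ)) [SFinite prior]
    (hn : n ≠ 0) {A : Set (Fin n → Fin n → ℝ)} (hA : MeasurableSet A) :
    gwigSpiked n lam prior A
      ≤ gwigUnspiked n A ^ (1 / 2 : ℝ)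
        * (∫⁻ q, ENNReal.ofReal (Real.exp (n * lam ^ 2 / 2 * (∑ i, q.1 i * q.2 i) ^ 2))
            ∂(prior.prod prior)) ^ (1 / 2 : ℝ) := by
  have hnR : (n : ℝ) ≠ 0 := by exact_mod_cast hn
  set v : ℝ≥0 := 1 / (2 * (n : ℝ≥0)) with hv
  have hv0 : v ≠ 0 := by simp [hv, hn]
  have hvR : (v : ℝ) = 1 / (2 * n) := by simp [hv]
  set Γ : Measure (Fin n × Fin n → ℝ) := Measure.pi fun _ => gaussianReal 0 v with hΓ
  set T : (Fin n × Fin n → ℝ) → Fin n → Fin n → ℝ := fun W i j => W (i, j) + W (j, i) with hT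
  have hTm : Measurable T := by fun_prop
  set m : (Fin n → ℝ) → Fin n × Fin n → ℝ := fun x p => lam / 2 * (x p.1 * x p.2) with hm
  set L : (Fin n → ℝ) → (Fin n × Fin n → ℝ) → ℝ≥0∞ := fun x W =>
    ∏ p, ENNReal.ofReal (Real.exp ((m x p * W p - m x p ^ 2 / 2) / v)) with hLdef
  have hL : Measurable (Function.uncurry L) := by
    simp only [hLdef, hm]
    unfold Function.uncurry
    fun_prop
  have hQ : gwigUnspiked n A = Γ (T ⁻¹' A) := Measure.map_apply hTm hA
  have hP (x : Fin n → ℝ) :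
      (gwigUnspiked n).map (fun Y i j => lam * (x i * x j) + Y i j) A = ∫⁻ W in T ⁻¹' A, L x W ∂Γ := by
    have hS : Measurable fun (Y : Fin n → Fin n → ℝ) i j => lam * (x i * x j) + Y i j := by fun_prop
    have hshift : Measurable fun (W : Fin n × Fin n → ℝ) p => W p + m x p := by fun_prop
    rw [← withDensity_apply _ (hTm hA), hΓ, ← map_add_pi_gaussianReal (m x) hv0, gwigUnspiked,
      Measure.map_map hS hTm, Measure.map_apply (hS.comp hTm) hA,
      Measure.map_apply hshift (hTm hA)]
    congr 1
    ext W
    simp only [Set.mem_preimage, Function.comp]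
    have : (fun i j => lam * (x i * x j) + T W i j) = T fun p => W p + m x p := by
      ext i j
      simp only [hT, hm]
      ring
    rw [this]
  have hLL (q : (Fin n → ℝ) × (Fin n → ℝ)) : ∫⁻ W, L q.1 W * L q.2 W ∂Γ
      = ENNReal.ofReal (Real.exp (n * lam ^ 2 / 2 * (∑ i, q.1 i * q.2 i) ^ 2)) := by
    simp only [hLdef, ← Finset.prod_mul_distrib]
    rw [hΓ, lintegral_pi_prod (fun _ : Fin n × Fin n => gaussianReal 0 v)
      (f := fun p w => ENNReal.ofReal (Real.exp ((m q.1 p * w - m q.1 p ^ 2 / 2) / v))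
        * ENNReal.ofReal (Real.exp ((m q.2 p * w - m q.2 p ^ 2 / 2) / v))) fun p => by fun_prop]
    simp_rw [lintegral_exp_mul_exp_gaussianReal _ _ hv0]
    rw [← ENNReal.ofReal_prod_of_nonneg fun i _ => (Real.exp_pos _).le, ← Real.exp_sum]
    congr 2
    rw [sq (∑ i, q.1 i * q.2 i), Finset.sum_mul_sum, Fintype.sum_prod_type, Finset.mul_sum]
    refine Finset.sum_congr rfl fun i _ => ?_
    rw [Finset.mul_sum]
    refine Finset.sum_congr rfl fun j _ => ?_
    simp only [hm, hvR]
    field_simp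
  calc gwigSpiked n lam prior A
      ≤ ∫⁻ x, (gwigUnspiked n).map (fun Y i j => lam * (x i * x j) + Y i j) A ∂prior :=
        Measure.bind_apply_le _ hA
    _ = ∫⁻ x, ∫⁻ W in T ⁻¹' A, L x W ∂Γ ∂prior := lintegral_congr hP
    _ ≤ _ := by
        rw [hQ, ← lintegral_congr hLL]
        exact lintegral_setLIntegral_le_sqrt_mul_sqrt prior Γ hL (hTm hA)

theorem lintegral_iidPrior_prod (π : Measure ℝ) [IsProbabilityMeasure π] {n : ℕ} (hn : n ≠ 0)
    (lam : ℝ) :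
    ∫⁻ q, ENNReal.ofReal (Real.exp (n * lam ^ 2 / 2 * (∑ i, q.1 i * q.2 i) ^ 2))
        ∂((iidPrior n π).prod (iidPrior n π))
      = ∫⁻ q : (Fin n → ℝ) × (Fin n → ℝ),
        ENNReal.ofReal (Real.exp (lam ^ 2 / (2 * n) * (∑ i, q.1 i * q.2 i) ^ 2))
        ∂((Measure.pi fun _ : Fin n => π).prod (Measure.pi fun _ : Fin n => π)) := by
  have hnR : (n : ℝ) ≠ 0 := by exact_mod_cast hn
  have hs : Measurable fun v : Fin n → ℝ => (√n)⁻¹ • v := by fun_prop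
  rw [iidPrior, Measure.map_prod_map _ _ hs hs, lintegral_map (by fun_prop) (by fun_prop)]
  refine lintegral_congr fun q => ?_
  have h : ∑ i, ((√n)⁻¹ • q.1) i * ((√n)⁻¹ • q.2) i = (n : ℝ)⁻¹ * ∑ i, q.1 i * q.2 i := by
    rw [Finset.mul_sum]
    refine Finset.sum_congr rfl fun i _ => ?_
    simp only [Pi.smul_apply, smul_eq_mul]
    rw [mul_mul_mul_comm, ← mul_inv, Real.mul_self_sqrt (Nat.cast_nonneg n)]
  simp only [Prod.map]
  rw [h]
  congr 2
  field_simp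

theorem contiguous_gwigSpiked_of_tendsto (π : Measure ℝ) [IsProbabilityMeasure π] (lam : ℝ)
    {c : ℝ≥0∞} (hc : c ≠ ∞)
    (h : Tendsto (fun n : ℕ => ∫⁻ q : (Fin n → ℝ) × (Fin n → ℝ),
        ENNReal.ofReal (Real.exp (lam ^ 2 / (2 * n) * (∑ i, q.1 i * q.2 i) ^ 2))
        ∂((Measure.pi fun _ : Fin n => π).prod (Measure.pi fun _ : Fin n => π)))
      atTop (𝓝 c)) :
    Contiguous (fun n => gwigSpiked n lam (iidPrior n π)) (fun n => gwigUnspiked n) := by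
  intro A hA hQ
  have hsfin (n : ℕ) : SFinite (iidPrior n π) := by unfold iidPrior; infer_instance
  have hlim := ENNReal.Tendsto.mul (hQ.ennrpow_const (1 / 2)) (Or.inr (ENNReal.rpow_ne_top_of_nonneg
    (by norm_num : (0 : ℝ) ≤ 1 / 2) hc)) (h.ennrpow_const (1 / 2)) (Or.inr (by simp))
  rw [ENNReal.zero_rpow_of_pos (by norm_num), zero_mul] at hlim
  refine tendsto_of_tendsto_of_tendsto_of_le_of_le' tendsto_const_nhds hlim
    (Eventually.of_forall fun n => zero_le) ?_
  filter_upwards [eventually_ne_atTop 0] with n hn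
  rw [← lintegral_iidPrior_prod π hn lam]
  exact gwigSpiked_apply_le n lam (iidPrior n π) hn (hA n)

/-- Sub-Gaussian method: if `π` has mean 0 and variance 1 and the product of two
independent copies of `π` is sub-Gaussian with variance proxy `σ²`, then for
`0 ≤ λ < 1/σ` the second moment
`E exp((λ²/(2n)) (∑_{i=1}^n X_i X'_i)²)` converges to `(1-λ²)^{-1/2}`, and
`GWig(λ, iid(π))` is contiguous to `GWig(0)`. -/
theorem stmt_6 (π : Measure ℝ) [IsProbabilityMeasure π]
    (hm : Integrable (fun x => x) π) (hmean : ∫ x, x ∂π = 0)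
    (hv : Integrable (fun x => x ^ 2) π) (hvar : ∫ x, x ^ 2 ∂π = 1)
    (σ : ℝ) (hσ : 0 < σ)
    (hsub : ∀ t : ℝ, ∫⁻ q : ℝ × ℝ, ENNReal.ofReal (Real.exp (t * (q.1 * q.2))) ∂(π.prod π)
      ≤ ENNReal.ofReal (Real.exp (σ ^ 2 * t ^ 2 / 2)))
    (lam : ℝ) (hlam0 : 0 ≤ lam) (hlam : lam < 1 / σ) :
    Tendsto (fun n : ℕ => ∫⁻ q : (Fin n → ℝ) × (Fin n → ℝ),
        ENNReal.ofReal (Real.exp (lam ^ 2 / (2 * n) * (∑ i, q.1 i * q.2 i) ^ 2))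
        ∂((Measure.pi fun _ : Fin n => π).prod (Measure.pi fun _ : Fin n => π)))
      atTop (𝓝 (ENNReal.ofReal ((1 - lam ^ 2) ^ (-(1 : ℝ) / 2))))
    ∧ Contiguous (fun n => gwigSpiked n lam (iidPrior n π)) (fun n => gwigUnspiked n) := by
  have h := tendsto_lintegral_exp_sq_sum π hmean hvar hσ hsub hlam0 hlam
  exact ⟨h, contiguous_gwigSpiked_of_tendsto π lam ENNReal.ofReal_ne_top h⟩
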